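/- Let A = ⊕_{i=1}^k A_i be a direct sum of Hilbert spaces with dim A_i = d_i, let Π_i be the orthogonal projection onto A_i, and let P(ρ) := Σ_{i=1}^k Π_i ρ Π_i be the pinching channel. Then the mutual information of P equals I(P) = log Δ with Δ := Σ_{i=1}^k d_i², and the maximum in I(P) = max_{ρ_A} I(P|ρ_A) is achieved at the input state ρ* = Σ_{i=1}^k (d_i/Δ) Π_i; more precisely, over block-uniform inputs ρ = Σ_i p_i Π_i/d_i one has I(P|ρ) = log Δ − D(p ‖ (d_i²/Δ)_i), where D is the Kullback–Leibler divergence of probability vectors. -/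

import Mathlib

open scoped Kronecker ComplexOrder
open Matrix

noncomputable section

namespace QIT

/-- Base-2 logarithm of a Hermitian matrix, via the spectral theorem
(junk value `0` on non-Hermitian inputs). -/
def matLog {ι : Type*} [Fintype ι] [DecidableEq ι] (ρ : Matrix ι ι ℂ) : Matrix ι ι ℂ :=
  if h : ρ.IsHermitian then
    (h.eigenvectorUnitary : Matrix ι ι ℂ) *
      Matrix.diagonal (fun i => (Real.logb 2 (h.eigenvalues i) : ℂ)) *
      star (h.eigenvectorUnitary : Matrix ι ι ℂ)
  else 0

/-- Von Neumann entropy (base 2): `S(ρ) = -tr[ρ log ρ]`. -/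
def entropy {ι : Type*} [Fintype ι] [DecidableEq ι] (ρ : Matrix ι ι ℂ) : ℝ :=
  -(ρ * matLog ρ).trace.re

/-- Quantum relative entropy (base 2): `D(ρ‖σ) = tr[ρ (log ρ - log σ)]`. -/
def relEnt {ι : Type*} [Fintype ι] [DecidableEq ι] (ρ σ : Matrix ι ι ℂ) : ℝ :=
  (ρ * (matLog ρ - matLog σ)).trace.re

/-- A quantum state: positive semidefinite with unit trace. -/
def IsState {ι : Type*} [Fintype ι] (ρ : Matrix ι ι ℂ) : Prop :=
  ρ.PosSemidef ∧ ρ.trace = 1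

/-- A pure state: a rank-one outer product `|v⟩⟨v|`. -/
def IsPure {ι : Type*} [Fintype ι] (ρ : Matrix ι ι ℂ) : Prop :=
  ∃ v : ι → ℂ, ρ = Matrix.vecMulVec v (star v)

/-- Partial trace over the second (right) tensor factor. -/
def ptrR {α β : Type*} [Fintype β] (ρ : Matrix (α × β) (α × β) ℂ) : Matrix α α ℂ :=
  Matrix.of fun a a' => ∑ b, ρ (a, b) (a', b)

/-- Partial trace over the first (left) tensor factor. -/
def ptrL {α β : Type*} [Fintype α] (ρ : Matrix (α × β) (α × β) ℂ) : Matrix β β ℂ :=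
  Matrix.of fun b b' => ∑ a, ρ (a, b) (a, b')

/-- Quantum mutual information `I(A:B) = S(ρ_A) + S(ρ_B) - S(ρ_{AB})` (entropy form). -/
def mutualInfoS {α β : Type*} [Fintype α] [DecidableEq α] [Fintype β] [DecidableEq β]
    (ρ : Matrix (α × β) (α × β) ℂ) : ℝ :=
  entropy (ptrR ρ) + entropy (ptrL ρ) - entropy ρ

/-- Quantum mutual information `I(A:B) = D(ρ_{AB} ‖ ρ_A ⊗ ρ_B)` (relative-entropy form). -/
def mutualInfoD {α β : Type*} [Fintype α] [DecidableEq α] [Fintype β] [DecidableEq β]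
    (ρ : Matrix (α × β) (α × β) ℂ) : ℝ :=
  relEnt ρ (ptrR ρ ⊗ₖ ptrL ρ)

/-- Tensoring a linear map on matrices with the identity on the left: `id_γ ⊗ L`. -/
def lTensor {α β : Type*} (γ : Type*) (L : Matrix α α ℂ →ₗ[ℂ] Matrix β β ℂ) :
    Matrix (γ × α) (γ × α) ℂ →ₗ[ℂ] Matrix (γ × β) (γ × β) ℂ where
  toFun ρ := Matrix.of fun p q => L (Matrix.of fun a a' => ρ (p.1, a) (q.1, a')) p.2 q.2
  map_add' ρ σ := by
    ext p q
    have h : (Matrix.of fun a a' => ρ (p.1, a) (q.1, a') + σ (p.1, a) (q.1, a')) =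
        (Matrix.of fun a a' => ρ (p.1, a) (q.1, a')) +
          Matrix.of fun a a' => σ (p.1, a) (q.1, a') := rfl
    simp only [Matrix.of_apply, Matrix.add_apply, h, map_add]
  map_smul' c ρ := by
    ext p q
    have h : (Matrix.of fun a a' => c * ρ (p.1, a) (q.1, a')) =
        c • Matrix.of fun a a' => ρ (p.1, a) (q.1, a') := rfl
    simp only [Matrix.of_apply, Matrix.smul_apply, smul_eq_mul, RingHom.id_apply, h,
      _root_.map_smul]

/-- Tensoring a linear map on matrices with the identity on the right: `L ⊗ id_γ`. -/
def rTensor {α β : Type*} (γ : Type*) (L : Matrix α α ℂ →ₗ[ℂ] Matrix β β ℂ) :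
    Matrix (α × γ) (α × γ) ℂ →ₗ[ℂ] Matrix (β × γ) (β × γ) ℂ where
  toFun ρ := Matrix.of fun p q => L (Matrix.of fun a a' => ρ (a, p.2) (a', q.2)) p.1 q.1
  map_add' ρ σ := by
    ext p q
    have h : (Matrix.of fun a a' => ρ (a, p.2) (a', q.2) + σ (a, p.2) (a', q.2)) =
        (Matrix.of fun a a' => ρ (a, p.2) (a', q.2)) +
          Matrix.of fun a a' => σ (a, p.2) (a', q.2) := rfl
    simp only [Matrix.of_apply, Matrix.add_apply, h, map_add]
  map_smul' c ρ := by
    ext p q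
    have h : (Matrix.of fun a a' => c * ρ (a, p.2) (a', q.2)) =
        c • Matrix.of fun a a' => ρ (a, p.2) (a', q.2) := rfl
    simp only [Matrix.of_apply, Matrix.smul_apply, smul_eq_mul, RingHom.id_apply, h,
      _root_.map_smul]

/-- A quantum channel: a completely positive trace-preserving linear map. -/
structure QChannel (α β : Type*) [Fintype α] [DecidableEq α] [Fintype β] [DecidableEq β] where
  map : Matrix α α ℂ →ₗ[ℂ] Matrix β β ℂ
  cp : ∀ (n : ℕ) (ρ : Matrix (Fin n × α) (Fin n × α) ℂ), ρ.PosSemidef →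
    ((lTensor (Fin n) map) ρ).PosSemidef
  tp : ∀ ρ : Matrix α α ℂ, (map ρ).trace = ρ.trace

/-- The classical-quantum state `Σ_x p(x) |x⟩⟨x| ⊗ σ^x`. -/
def cqState {ι γ : Type*} [DecidableEq ι] (p : ι → ℝ) (σ : ι → Matrix γ γ ℂ) :
    Matrix (ι × γ) (ι × γ) ℂ :=
  Matrix.of fun a b => if a.1 = b.1 then (p a.1 : ℂ) * σ a.1 a.2 b.2 else 0

/-- A probability distribution on a finite alphabet. -/
def IsProbDist {ι : Type*} [Fintype ι] (p : ι → ℝ) : Prop :=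
  (∀ x, 0 ≤ p x) ∧ ∑ x, p x = 1

section Assisted

variable {EA EB A B : Type*} [Fintype EA] [DecidableEq EA] [Fintype EB] [DecidableEq EB]
  [Fintype A] [DecidableEq A] [Fintype B] [DecidableEq B]

/-- The output state `(N ∘ E ⊗ id_{E_B})(ρ_{E_AE_B})` on `B ⊗ E_B`. -/
def assistedOut (N : QChannel A B) (E : QChannel EA A)
    (ρ : Matrix (EA × EB) (EA × EB) ℂ) : Matrix (B × EB) (B × EB) ℂ :=
  rTensor EB (N.map ∘ₗ E.map) ρ

/-- The classical-quantum state
`ω_{XBE_B} = Σ_x p(x) |x⟩⟨x|_X ⊗ (N∘E^x ⊗ id_{E_B})(ρ_{E_AE_B})`. -/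
def assistedCQ (N : QChannel A B) (ρ : Matrix (EA × EB) (EA × EB) ℂ)
    {n : ℕ} (p : Fin n → ℝ) (E : Fin n → QChannel EA A) :
    Matrix (Fin n × (B × EB)) (Fin n × (B × EB)) ℂ :=
  cqState p fun x => assistedOut N (E x) ρ

/-- Marginal of a state on `X ⊗ (B ⊗ E_B)` obtained by tracing out `B`. -/
def margXE {X : Type*} (ω : Matrix (X × (B × EB)) (X × (B × EB)) ℂ) :
    Matrix (X × EB) (X × EB) ℂ :=
  Matrix.of fun p q => ∑ b, ω (p.1, (b, p.2)) (q.1, (b, q.2))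

/-- `I(XE_B:B)` of a state on `X ⊗ (B ⊗ E_B)` (entropy form). -/
def infoXE_B {X : Type*} [Fintype X] [DecidableEq X]
    (ω : Matrix (X × (B × EB)) (X × (B × EB)) ℂ) : ℝ :=
  entropy (margXE ω) + entropy (ptrR (ptrL ω)) - entropy ω

/-- Regrouping `(X × E_B) × B ≃ X × (B × E_B)`. -/
def regroupEquiv (X B EB : Type*) : (X × EB) × B ≃ X × (B × EB) :=
  (Equiv.prodAssoc X EB B).trans (Equiv.prodCongr (Equiv.refl X) (Equiv.prodComm EB B))

/-- `I(XE_B:B)` of a state on `X ⊗ (B ⊗ E_B)` (relative-entropy form). -/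
def infoXE_B_D {X : Type*} [Fintype X] [DecidableEq X]
    (ω : Matrix (X × (B × EB)) (X × (B × EB)) ℂ) : ℝ :=
  mutualInfoD (ω.submatrix (regroupEquiv X B EB) (regroupEquiv X B EB))

/-- The `ρ`-assisted Holevo information `χ_ρ(N)` (entropy form of `I`). -/
def assistedHolevoS (N : QChannel A B) (ρ : Matrix (EA × EB) (EA × EB) ℂ) : ℝ :=
  sSup { r | ∃ (n : ℕ) (p : Fin n → ℝ) (E : Fin n → QChannel EA A),
    IsProbDist p ∧ r = mutualInfoS (assistedCQ N ρ p E) }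

/-- The `ρ`-assisted Holevo information `χ_ρ(N)` (relative-entropy form of `I`). -/
def assistedHolevoD (N : QChannel A B) (ρ : Matrix (EA × EB) (EA × EB) ℂ) : ℝ :=
  sSup { r | ∃ (n : ℕ) (p : Fin n → ℝ) (E : Fin n → QChannel EA A),
    IsProbDist p ∧ r = mutualInfoD (assistedCQ N ρ p E) }

/-- The `ρ`-assisted mutual information `I_ρ(N)` (entropy form of `I`). -/
def assistedMutualS (N : QChannel A B) (ρ : Matrix (EA × EB) (EA × EB) ℂ) : ℝ :=
  sSup { r | ∃ (n : ℕ) (p : Fin n → ℝ) (E : Fin n → QChannel EA A),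
    IsProbDist p ∧ r = infoXE_B (assistedCQ N ρ p E) }

/-- The `ρ`-assisted mutual information `I_ρ(N)` (relative-entropy form of `I`). -/
def assistedMutualD (N : QChannel A B) (ρ : Matrix (EA × EB) (EA × EB) ℂ) : ℝ :=
  sSup { r | ∃ (n : ℕ) (p : Fin n → ℝ) (E : Fin n → QChannel EA A),
    IsProbDist p ∧ r = infoXE_B_D (assistedCQ N ρ p E) }

/-- The (unassisted) Holevo information `χ(N)` (entropy form of `I`). -/
def holevoS (N : QChannel A B) : ℝ :=
  sSup { r | ∃ (n : ℕ) (p : Fin n → ℝ) (σ : Fin n → Matrix A A ℂ),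
    IsProbDist p ∧ (∀ x, IsState (σ x)) ∧
    r = mutualInfoS (cqState p fun x => N.map (σ x)) }

/-- The (unassisted) Holevo information `χ(N)` (relative-entropy form of `I`). -/
def holevoD (N : QChannel A B) : ℝ :=
  sSup { r | ∃ (n : ℕ) (p : Fin n → ℝ) (σ : Fin n → Matrix A A ℂ),
    IsProbDist p ∧ (∀ x, IsState (σ x)) ∧
    r = mutualInfoD (cqState p fun x => N.map (σ x)) }

end Assisted

section ChannelMI

variable {A B : Type*} [Fintype A] [DecidableEq A] [Fintype B] [DecidableEq B]

/-- `φ_{AA'}` is a purification of `ρ_A`: a pure state whose marginal on the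
first factor is `ρ_A`. -/
def IsPurification {A' : Type*} [Fintype A']
    (φ : Matrix (A × A') (A × A') ℂ) (ρ : Matrix A A ℂ) : Prop :=
  IsState φ ∧ IsPure φ ∧ ptrR φ = ρ

/-- The mutual information of the channel `N`,
`I(N) = max_{ρ_A} I(A':B)_{(N ⊗ id)(φ_{AA'})}` (purifying system `A' ≅ A`). -/
def channelMI (N : QChannel A B) : ℝ :=
  sSup { r | ∃ (ρA : Matrix A A ℂ) (φ : Matrix (A × A) (A × A) ℂ),
    IsState ρA ∧ IsPurification φ ρA ∧ r = mutualInfoS (rTensor A N.map φ) }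

end ChannelMI

section Coding

variable {EA EB A B : Type*} [Fintype EA] [DecidableEq EA] [Fintype EB] [DecidableEq EB]
  [Fintype A] [DecidableEq A] [Fintype B] [DecidableEq B]

/-- Product of `n` states on `B ⊗ E_B`, arranged on `B^n ⊗ E_B^n`. -/
def prodState {n : ℕ} (τ : Fin n → Matrix (B × EB) (B × EB) ℂ) :
    Matrix ((Fin n → B) × (Fin n → EB)) ((Fin n → B) × (Fin n → EB)) ℂ :=
  Matrix.of fun p q => ∏ i, τ i (p.1 i, p.2 i) (q.1 i, q.2 i)

/-- Product of `n` states on `B ⊗ E_B`, with the `B^n` systems permuted by `π`. -/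
def permProdState {n : ℕ} (π : Equiv.Perm (Fin n))
    (τ : Fin n → Matrix (B × EB) (B × EB) ℂ) :
    Matrix ((Fin n → B) × (Fin n → EB)) ((Fin n → B) × (Fin n → EB)) ℂ :=
  Matrix.of fun p q => ∏ i, τ i (p.1 (π i), p.2 i) (q.1 (π i), q.2 i)

/-- Average decoding error probability of a code with message-dependent output
states `ω^m` and decoding POVM `{Λ_m}`. -/
def avgErr {n M : ℕ}
    (ω : Fin M → Matrix ((Fin n → B) × (Fin n → EB)) ((Fin n → B) × (Fin n → EB)) ℂ)
    (Λ : Fin M → Matrix ((Fin n → B) × (Fin n → EB)) ((Fin n → B) × (Fin n → EB)) ℂ) : ℝ :=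
  (1 / (M : ℝ)) * ∑ m, ((1 - Λ m) * ω m).trace.re

/-- Existence of a blocklength-`n`, `M`-message, error-`≤ ε` code with product
encodings for the state-channel pair `(ρ, N)`. -/
def ProdCode (N : QChannel A B) (ρ : Matrix (EA × EB) (EA × EB) ℂ)
    (n M : ℕ) (ε : ℝ) : Prop :=
  ∃ (Enc : Fin M → Fin n → QChannel EA A)
    (Λ : Fin M → Matrix ((Fin n → B) × (Fin n → EB)) ((Fin n → B) × (Fin n → EB)) ℂ),
    (∀ m, (Λ m).PosSemidef) ∧ (∑ m, Λ m) = 1 ∧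
    avgErr (fun m => prodState fun i => assistedOut N (Enc m i) ρ) Λ ≤ ε

/-- Existence of a blocklength-`n`, `M`-message, error-`≤ ε` code with
semi-global encodings (local encodings followed by a global permutation). -/
def SemiGlobalCode (N : QChannel A B) (ρ : Matrix (EA × EB) (EA × EB) ℂ)
    (n M : ℕ) (ε : ℝ) : Prop :=
  ∃ (Enc : Fin M → Fin n → QChannel EA A) (perm : Fin M → Equiv.Perm (Fin n))
    (Λ : Fin M → Matrix ((Fin n → B) × (Fin n → EB)) ((Fin n → B) × (Fin n → EB)) ℂ),
    (∀ m, (Λ m).PosSemidef) ∧ (∑ m, Λ m) = 1 ∧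
    avgErr (fun m => permProdState (perm m) fun i => assistedOut N (Enc m i) ρ) Λ ≤ ε

/-- `R` is an `ε`-achievable rate with product encodings. -/
def ProdAchievable (N : QChannel A B) (ρ : Matrix (EA × EB) (EA × EB) ℂ)
    (ε R : ℝ) : Prop :=
  ∀ δ : ℝ, 0 < δ → ∃ n₀ : ℕ, ∀ n ≥ n₀, ∃ M : ℕ,
    R - δ ≤ Real.logb 2 M / n ∧ ProdCode N ρ n M ε

/-- `R` is an `ε`-achievable rate with semi-global encodings. -/
def SemiGlobalAchievable (N : QChannel A B) (ρ : Matrix (EA × EB) (EA × EB) ℂ)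
    (ε R : ℝ) : Prop :=
  ∀ δ : ℝ, 0 < δ → ∃ n₀ : ℕ, ∀ n ≥ n₀, ∃ M : ℕ,
    R - δ ≤ Real.logb 2 M / n ∧ SemiGlobalCode N ρ n M ε

/-- The `ρ`-assisted `ε`-classical capacity with product encodings. -/
def prodCapacity (N : QChannel A B) (ρ : Matrix (EA × EB) (EA × EB) ℂ) (ε : ℝ) : ℝ :=
  sSup { R | ProdAchievable N ρ ε R }

/-- The `ρ`-assisted `ε`-classical capacity with semi-global encodings. -/
def semiGlobalCapacity (N : QChannel A B) (ρ : Matrix (EA × EB) (EA × EB) ℂ) (ε : ℝ) : ℝ :=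
  sSup { R | SemiGlobalAchievable N ρ ε R }

end Coding

/-- The phase (Weyl) unitary `Z^u = Σ_z e^{2πiuz/d}|z⟩⟨z|` on `ℂ^d`. -/
def Zmat (d : ℕ) (u : Fin d) : Matrix (Fin d) (Fin d) ℂ :=
  Matrix.diagonal fun z => Complex.exp (2 * Real.pi * Complex.I * u.1 * z.1 / d)

/-- Conjugation of a bipartite state by the phase unitary `Z^u ⊗ 1`. -/
def phaseConj {EB : Type*} [Fintype EB] [DecidableEq EB] (d : ℕ) (u : Fin d)
    (φ : Matrix (Fin d × EB) (Fin d × EB) ℂ) : Matrix (Fin d × EB) (Fin d × EB) ℂ :=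
  (Zmat d u ⊗ₖ (1 : Matrix EB EB ℂ)) * φ * (Zmat d u ⊗ₖ (1 : Matrix EB EB ℂ))ᴴ

/-- The (unnormalized) conditional operator `⟨z|φ|z⟩` on `E_B`. -/
def condState {EB : Type*} {d : ℕ} (φ : Matrix (Fin d × EB) (Fin d × EB) ℂ)
    (z : Fin d) : Matrix EB EB ℂ :=
  Matrix.of fun e e' => φ (z, e) (z, e')

/-- Shannon entropy (base 2) of a probability vector. -/
def shannonEnt {ι : Type*} [Fintype ι] (p : ι → ℝ) : ℝ :=
  -∑ i, p i * Real.logb 2 (p i)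

/-- Binary entropy (base 2). -/
def binEnt (p : ℝ) : ℝ :=
  -(p * Real.logb 2 p) - (1 - p) * Real.logb 2 (1 - p)

/-- Kullback-Leibler divergence (base 2) between probability vectors. -/
def klDiv {ι : Type*} [Fintype ι] (p q : ι → ℝ) : ℝ :=
  ∑ i, p i * Real.logb 2 (p i / q i)

section Discord

variable {α β : Type*} [Fintype α] [DecidableEq α] [Fintype β] [DecidableEq β]

/-- The (unnormalized) operator `⟨v|ρ|v⟩` on `α`, sandwiching on the second factor. -/
def sandwichR (ρ : Matrix (α × β) (α × β) ℂ) (v : β → ℂ) : Matrix α α ℂ :=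
  Matrix.of fun a a' => ∑ b, ∑ b', star (v b) * ρ (a, b) (a', b') * v b'

/-- The relative entropy of discord `D_R(ρ_{AB})`. -/
def relEntDiscord (ρ : Matrix (α × β) (α × β) ℂ) : ℝ :=
  sInf { r | ∃ V ∈ Matrix.unitaryGroup β ℂ, r = relEnt ρ
    (∑ y : β, sandwichR ρ (fun b => V b y) ⊗ₖ
      Matrix.vecMulVec (fun b => V b y) (star fun b => V b y)) }

/-- The discord of formation `D_F(ρ_{AB})`. -/
def discordOfFormation (ρ : Matrix (α × β) (α × β) ℂ) : ℝ :=
  sInf { r | ∃ (n : ℕ) (p : Fin n → ℝ) (τ : Fin n → Matrix (α × β) (α × β) ℂ),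
    IsProbDist p ∧ (∀ x, IsState (τ x)) ∧ (ρ = ∑ x, (p x : ℂ) • τ x) ∧
    r = ∑ x, p x * relEntDiscord (τ x) }

end Discord

/-- The index type of the direct sum `⊕_{i=1}^k A_i` with `dim A_i = d i`. -/
abbrev DirectSumIdx (k : ℕ) (d : Fin k → ℕ) : Type := (i : Fin k) × Fin (d i)

section Entropy

variable {m n : Type*} [Fintype m] [DecidableEq m] [Fintype n] [DecidableEq n]

lemma entropy_eq_sum_eigenvalues {ρ : Matrix n n ℂ} (h : ρ.IsHermitian) :
    entropy ρ = (∑ i, Real.negMulLog (h.eigenvalues i)) / Real.log 2 := by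
  set U : Matrix n n ℂ := (h.eigenvectorUnitary : Matrix n n ℂ) with hU
  have hUU : star U * U = 1 := Unitary.coe_star_mul_self h.eigenvectorUnitary
  have hρ : ρ = U * diagonal (fun i => (h.eigenvalues i : ℂ)) * star U := by
    have := h.spectral_theorem
    rwa [Unitary.conjStarAlgAut_apply] at this
  have hL : matLog ρ =
      U * diagonal (fun i => (Real.logb 2 (h.eigenvalues i) : ℂ)) * star U := by
    rw [matLog, dif_pos h]
  have hprod : ρ * matLog ρ = U * (diagonal (fun i => (h.eigenvalues i : ℂ)) *
      diagonal (fun i => (Real.logb 2 (h.eigenvalues i) : ℂ))) * star U := by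
    rw [hL]
    conv_lhs => enter [1]; rw [hρ]
    simp only [Matrix.mul_assoc]
    rw [← Matrix.mul_assoc (star U) U, hUU, Matrix.one_mul]
  rw [entropy, hprod, Matrix.trace_mul_comm, ← Matrix.mul_assoc, hUU, Matrix.one_mul,
    diagonal_mul_diagonal, trace_diagonal, Complex.re_sum, ← Finset.sum_neg_distrib,
    Finset.sum_div]
  refine Finset.sum_congr rfl fun i _ => ?_
  rw [← Complex.ofReal_mul, Complex.ofReal_re, Real.negMulLog, Real.logb]
  ring

lemma entropy_eq_sum_roots {ρ : Matrix n n ℂ} (h : ρ.IsHermitian) :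
    entropy ρ = (ρ.charpoly.roots.map fun z => Real.negMulLog z.re).sum / Real.log 2 := by
  rw [entropy_eq_sum_eigenvalues h, h.roots_charpoly_eq_eigenvalues, Multiset.map_map]
  rfl

lemma entropy_transpose {ρ : Matrix n n ℂ} (h : ρ.IsHermitian) : entropy ρᵀ = entropy ρ := by
  rw [entropy_eq_sum_roots h, entropy_eq_sum_roots h.transpose, charpoly_transpose]

lemma entropy_diagonal (f : n → ℝ) :
    entropy (diagonal fun i => (f i : ℂ)) = (∑ i, Real.negMulLog (f i)) / Real.log 2 := by
  have h : (diagonal fun i => (f i : ℂ)).IsHermitian :=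
    isHermitian_diagonal_of_self_adjoint _ (by ext i; simp)
  rw [entropy_eq_sum_roots h, charpoly_diagonal, Polynomial.roots_prod]
  · simp
  · simp [Finset.prod_ne_zero_iff, Polynomial.X_sub_C_ne_zero]

/-- The two Gram matrices of a rectangular matrix have the same nonzero spectrum, hence the same
entropy. -/
lemma entropy_mul_conjTranspose_self (W : Matrix m n ℂ) : entropy (W * Wᴴ) = entropy (Wᴴ * W) := by
  rw [entropy_eq_sum_roots (isHermitian_mul_conjTranspose_self W),
    entropy_eq_sum_roots (isHermitian_conjTranspose_mul_self W)]
  have key := congrArg (fun p => (p.roots.map fun z : ℂ => Real.negMulLog z.re).sum)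
    (charpoly_mul_comm' W Wᴴ)
  have hne : ∀ (r : ℕ) {p : Polynomial ℂ}, p.Monic → (Polynomial.X : Polynomial ℂ) ^ r * p ≠ 0 :=
    fun r p hp => mul_ne_zero (pow_ne_zero _ Polynomial.X_ne_zero) hp.ne_zero
  simp only [Polynomial.roots_mul (hne _ (charpoly_monic _)), Polynomial.roots_X_pow,
    Multiset.map_add, Multiset.sum_add, Multiset.map_nsmul, Multiset.sum_nsmul,
    Multiset.map_singleton, Multiset.sum_singleton, Complex.zero_re, Real.negMulLog_zero,
    smul_zero, zero_add] at key
  rw [key]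

/-- The entropy does not decrease when a state is dephased in the computational basis. -/
lemma entropy_le_sum_diag {ρ : Matrix n n ℂ} (h : ρ.PosSemidef) :
    entropy ρ ≤ (∑ a, Real.negMulLog (ρ a a).re) / Real.log 2 := by
  have hH := h.isHermitian
  rw [entropy_eq_sum_eigenvalues hH]
  set U : Matrix n n ℂ := (hH.eigenvectorUnitary : Matrix n n ℂ) with hU
  have hUU : star U * U = 1 := Unitary.coe_star_mul_self hH.eigenvectorUnitary
  have hUU' : U * star U = 1 := Unitary.coe_mul_star_self hH.eigenvectorUnitary
  have hρ : ρ = U * diagonal (fun i => (hH.eigenvalues i : ℂ)) * star U := by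
    have := hH.spectral_theorem
    rwa [Unitary.conjStarAlgAut_apply] at this
  have hdiag : ∀ a, (ρ a a).re = ∑ j, Complex.normSq (U a j) * hH.eigenvalues j := by
    intro a
    conv_lhs => rw [hρ]
    rw [Matrix.mul_apply, Complex.re_sum]
    refine Finset.sum_congr rfl fun j _ => ?_
    rw [mul_diagonal, star_apply, mul_right_comm, Complex.star_def, Complex.mul_conj,
      ← Complex.ofReal_mul, Complex.ofReal_re]
  have hrow : ∀ a, ∑ j, Complex.normSq (U a j) = 1 := by
    intro a
    have := congrArg Complex.re (congrFun (congrFun hUU' a) a)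
    simpa [Matrix.mul_apply, Complex.mul_conj, star_apply] using this
  have hcol : ∀ j, ∑ a, Complex.normSq (U a j) = 1 := by
    intro j
    have := congrArg Complex.re (congrFun (congrFun hUU j) j)
    simpa [Matrix.mul_apply, mul_comm, Complex.mul_conj, star_apply] using this
  refine div_le_div_of_nonneg_right ?_ (Real.log_nonneg one_le_two)
  calc ∑ j, Real.negMulLog (hH.eigenvalues j)
      = ∑ a, ∑ j, Complex.normSq (U a j) * Real.negMulLog (hH.eigenvalues j) := by
        rw [Finset.sum_comm]
        simp_rw [← Finset.sum_mul, hcol, one_mul]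
    _ ≤ ∑ a, Real.negMulLog (ρ a a).re := by
        refine Finset.sum_le_sum fun a _ => ?_
        rw [hdiag]
        exact Real.concaveOn_negMulLog.le_map_sum (fun j _ => Complex.normSq_nonneg _) (hrow a)
          fun j _ => h.eigenvalues_nonneg j

end Entropy

lemma sum_negMulLog_le {n : Type*} [Fintype n] [Nonempty n] (x : n → ℝ) (hx : ∀ i, 0 ≤ x i) :
    ∑ i, Real.negMulLog (x i) ≤
      Fintype.card n * Real.negMulLog ((∑ i, x i) / Fintype.card n) := by
  have hc : (0 : ℝ) < Fintype.card n := by exact_mod_cast Fintype.card_pos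
  have := Real.concaveOn_negMulLog.le_map_sum (t := Finset.univ)
    (w := fun _ : n => (Fintype.card n : ℝ)⁻¹) (p := x) (fun _ _ => by positivity)
    (by simp [hc.ne']) (fun i _ => hx i)
  simp only [smul_eq_mul, ← Finset.mul_sum] at this
  rw [inv_mul_le_iff₀ hc, inv_mul_eq_div] at this
  exact this

lemma klDiv_nonneg {ι : Type*} [Fintype ι] {p q : ι → ℝ} (hp : IsProbDist p)
    (hq : IsProbDist q) (hq0 : ∀ i, 0 < q i) : 0 ≤ klDiv p q := by
  have h2 : (0 : ℝ) < Real.log 2 := Real.log_pos one_lt_two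
  have key : ∀ i, (p i - q i) / Real.log 2 ≤ p i * Real.logb 2 (p i / q i) := by
    intro i
    rw [Real.logb, ← mul_div_assoc]
    refine div_le_div_of_nonneg_right ?_ h2.le
    rcases (hp.1 i).eq_or_lt with h0 | hpos
    · simp [← h0, (hq0 i).le]
    · have := Real.one_sub_inv_le_log_of_pos (div_pos hpos (hq0 i))
      calc p i - q i = p i * (1 - (p i / q i)⁻¹) := by field_simp
        _ ≤ _ := mul_le_mul_of_nonneg_left this hpos.le
  calc (0 : ℝ) = ∑ i, (p i - q i) / Real.log 2 := by
        rw [← Finset.sum_div, Finset.sum_sub_distrib, hp.2, hq.2, sub_self, zero_div]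
    _ ≤ klDiv p q := Finset.sum_le_sum fun i _ => key i

lemma klDiv_self {ι : Type*} [Fintype ι] (p : ι → ℝ) : klDiv p p = 0 := by
  refine Finset.sum_eq_zero fun i _ => ?_
  by_cases h : p i = 0 <;> simp [h]

section Pinching

variable {k : ℕ} {d : Fin k → ℕ}

/-- The probability of finding a state in the `i`-th block. -/
def blockProb (ρ : Matrix (DirectSumIdx k d) (DirectSumIdx k d) ℂ) (i : Fin k) : ℝ :=
  ∑ j, (ρ ⟨i, j⟩ ⟨i, j⟩).re

lemma blockProb_isProbDist {ρ : Matrix (DirectSumIdx k d) (DirectSumIdx k d) ℂ}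
    (hρ : IsState ρ) : IsProbDist (blockProb ρ) := by
  refine ⟨fun i => Finset.sum_nonneg fun j _ => ?_, ?_⟩
  · exact (Complex.nonneg_iff.mp hρ.1.diag_nonneg).1
  · have := congrArg Complex.re hρ.2
    simpa [Matrix.trace, Complex.re_sum, Fintype.sum_sigma, blockProb] using this

lemma dimDist_isProbDist {d : Fin k → ℕ} (h : 0 < ∑ i, (d i : ℝ) ^ 2) :
    IsProbDist fun i => (d i : ℝ) ^ 2 / ∑ j, (d j : ℝ) ^ 2 :=
  ⟨fun i => by positivity, by rw [← Finset.sum_div, div_self h.ne']⟩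

lemma sum_sq_dim_pos {p : Fin k → ℝ} (hd : ∀ i, 0 < d i) (hp : IsProbDist p) :
    0 < ∑ i, (d i : ℝ) ^ 2 := by
  have hne : Nonempty (Fin k) := by
    by_contra h
    have := not_nonempty_iff.mp h
    simpa using hp.2
  exact Finset.sum_pos (fun i _ => by have := hd i; positivity) Finset.univ_nonempty

/-- The entropy balance of a block-uniform input, expressed through the relative entropy. -/
lemma blockUniform_entropy_balance (hd : ∀ i, 0 < d i) {p : Fin k → ℝ} (hp : IsProbDist p) :
    (2 * ∑ i, (d i : ℝ) * Real.negMulLog (p i / d i) - ∑ i, Real.negMulLog (p i)) / Real.log 2 =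
      Real.logb 2 (∑ i, (d i : ℝ) ^ 2) -
        klDiv p (fun i => (d i : ℝ) ^ 2 / ∑ j, (d j : ℝ) ^ 2) := by
  have hΔ := sum_sq_dim_pos hd hp
  set Δ := ∑ i, (d i : ℝ) ^ 2
  have h1 : Real.logb 2 Δ = ∑ i, p i * Real.logb 2 Δ := by rw [← Finset.sum_mul, hp.2, one_mul]
  rw [h1, klDiv, ← Finset.sum_sub_distrib, Finset.mul_sum, ← Finset.sum_sub_distrib,
    Finset.sum_div]
  refine Finset.sum_congr rfl fun i _ => ?_
  have hdi : (0 : ℝ) < d i := by exact_mod_cast hd i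
  rcases (hp.1 i).eq_or_lt with h0 | hpos
  · simp [← h0]
  · simp only [Real.negMulLog, Real.logb]
    rw [Real.log_div hpos.ne' hdi.ne', Real.log_div hpos.ne' (by positivity),
      Real.log_div (by positivity) hΔ.ne', Real.log_pow]
    field_simp
    push_cast
    ring

lemma mutualInfoS_pinching_eq
    {N : QChannel (DirectSumIdx k d) (DirectSumIdx k d)}
    (hN : ∀ ρ : Matrix (DirectSumIdx k d) (DirectSumIdx k d) ℂ,
      N.map ρ = Matrix.of fun a b => if a.1 = b.1 then ρ a b else 0)
    {φ : Matrix (DirectSumIdx k d × DirectSumIdx k d) (DirectSumIdx k d × DirectSumIdx k d) ℂ}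
    {ρ : Matrix (DirectSumIdx k d) (DirectSumIdx k d) ℂ} (hφ : IsPurification φ ρ) :
    mutualInfoS (rTensor (DirectSumIdx k d) N.map φ) =
      entropy (N.map ρ) + entropy ρ -
        (∑ i, Real.negMulLog (blockProb ρ i)) / Real.log 2 := by
  obtain ⟨-, ⟨v, rfl⟩, rfl⟩ := hφ
  set φ := vecMulVec v (star v) with hφ
  let V : Matrix (DirectSumIdx k d) (DirectSumIdx k d) ℂ := Matrix.of fun a b => v (a, b)
  let W : Matrix (DirectSumIdx k d × DirectSumIdx k d) (Fin k) ℂ :=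
    Matrix.of fun x i => if x.1.1 = i then v x else 0
  have hρ : ptrR φ = V * Vᴴ := by
    ext a b
    simp [ptrR, φ, V, vecMulVec_apply, Matrix.mul_apply]
  have hR : ptrR (rTensor (DirectSumIdx k d) N.map φ) = N.map (ptrR φ) := by
    ext a b
    simp only [ptrR, rTensor, hN, LinearMap.coe_mk, AddHom.coe_mk, of_apply]
    split_ifs <;> simp
  have hL : ptrL (rTensor (DirectSumIdx k d) N.map φ) = (Vᴴ * V)ᵀ := by
    ext a b
    simp [ptrL, rTensor, hN, φ, V, vecMulVec_apply, Matrix.mul_apply, mul_comm]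
  have hW : rTensor (DirectSumIdx k d) N.map φ = W * Wᴴ := by
    ext x y
    simp [rTensor, hN, φ, W, vecMulVec_apply, Matrix.mul_apply, apply_ite, eq_comm]
    split_ifs <;> tauto
  have hWW : Wᴴ * W = diagonal fun i => (blockProb (ptrR φ) i : ℂ) := by
    ext i i'
    simp only [W, Matrix.mul_apply, conjTranspose_apply, of_apply, diagonal_apply,
      Fintype.sum_prod_type, Fintype.sum_sigma]
    split_ifs with h
    · subst h
      rw [Finset.sum_eq_single i (by intro b _ hb; simp [hb]) (by simp)]
      simp only [blockProb, ptrR, φ, vecMulVec_apply, of_apply, Pi.star_apply, Complex.star_def,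
        Complex.mul_conj, if_true, Complex.re_sum, Complex.ofReal_re, Complex.ofReal_sum,
        mul_comm ((starRingEnd ℂ) _), Fintype.sum_sigma]
    · refine Finset.sum_eq_zero fun b _ => Finset.sum_eq_zero fun j _ =>
        Finset.sum_eq_zero fun c _ => ?_
      by_cases hb : b = i
      · simp [hb, h]
      · simp [hb]
  rw [mutualInfoS, hR, hL, entropy_transpose (isHermitian_conjTranspose_mul_self V), hW,
    entropy_mul_conjTranspose_self W, hWW, entropy_diagonal, ← entropy_mul_conjTranspose_self, hρ]

lemma sum_negMulLog_diag_le_blockUniform {ρ : Matrix (DirectSumIdx k d) (DirectSumIdx k d) ℂ}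
    (hd : ∀ i, 0 < d i) (hρ : ρ.PosSemidef) :
    ∑ a, Real.negMulLog (ρ a a).re ≤
      ∑ i, (d i : ℝ) * Real.negMulLog (blockProb ρ i / d i) := by
  rw [Fintype.sum_sigma]
  refine Finset.sum_le_sum fun i _ => ?_
  have : Nonempty (Fin (d i)) := ⟨⟨0, hd i⟩⟩
  simpa [blockProb] using sum_negMulLog_le (fun j : Fin (d i) => (ρ ⟨i, j⟩ ⟨i, j⟩).re)
    fun j => (Complex.nonneg_iff.mp hρ.diag_nonneg).1

lemma mutualInfoS_pinching_le (hd : ∀ i, 0 < d i)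
    {N : QChannel (DirectSumIdx k d) (DirectSumIdx k d)}
    (hN : ∀ ρ : Matrix (DirectSumIdx k d) (DirectSumIdx k d) ℂ,
      N.map ρ = Matrix.of fun a b => if a.1 = b.1 then ρ a b else 0)
    {φ : Matrix (DirectSumIdx k d × DirectSumIdx k d) (DirectSumIdx k d × DirectSumIdx k d) ℂ}
    {ρ : Matrix (DirectSumIdx k d) (DirectSumIdx k d) ℂ} (hρ : IsState ρ)
    (hφ : IsPurification φ ρ) :
    mutualInfoS (rTensor (DirectSumIdx k d) N.map φ) ≤ Real.logb 2 (∑ i, (d i : ℝ) ^ 2) := by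
  have h2 : (0 : ℝ) < Real.log 2 := Real.log_pos one_lt_two
  have hp := blockProb_isProbDist hρ
  have hΔ := sum_sq_dim_pos hd hp
  have hkl := klDiv_nonneg hp (dimDist_isProbDist hΔ)
    fun i => div_pos (by have := hd i; positivity) hΔ
  have hbal := blockUniform_entropy_balance hd hp
  have hNρ : (N.map ρ).PosSemidef := by
    have hblock : N.map ρ = ∑ i, (diagonal fun a : DirectSumIdx k d => if a.1 = i then (1 : ℂ) else 0)
        * ρ * (diagonal fun a : DirectSumIdx k d => if a.1 = i then (1 : ℂ) else 0)ᴴ := by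
      ext a b
      simp [hN, Matrix.sum_apply, diagonal_conjTranspose, diagonal_mul, mul_diagonal, apply_ite,
        eq_comm]
      split_ifs <;> tauto
    rw [hblock]
    exact posSemidef_sum _ fun i _ => hρ.1.mul_mul_conjTranspose_same _
  have hE := entropy_le_sum_diag hρ.1
  have hE' := entropy_le_sum_diag hNρ
  have hdiag : ∀ a, N.map ρ a a = ρ a a := fun a => by simp [hN]
  simp only [hdiag] at hE'
  have hB := div_le_div_of_nonneg_right (sum_negMulLog_diag_le_blockUniform hd hρ.1) h2.le
  rw [sub_div, mul_div_assoc] at hbal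
  rw [mutualInfoS_pinching_eq hN hφ]
  linarith

lemma mutualInfoS_pinching_blockUniform (hd : ∀ i, 0 < d i)
    {N : QChannel (DirectSumIdx k d) (DirectSumIdx k d)}
    (hN : ∀ ρ : Matrix (DirectSumIdx k d) (DirectSumIdx k d) ℂ,
      N.map ρ = Matrix.of fun a b => if a.1 = b.1 then ρ a b else 0)
    {q : Fin k → ℝ} (hq : IsProbDist q)
    {φ : Matrix (DirectSumIdx k d × DirectSumIdx k d) (DirectSumIdx k d × DirectSumIdx k d) ℂ}
    (hφ : IsPurification φ (diagonal fun a => ((q a.1 / (d a.1 : ℝ) : ℝ) : ℂ))) :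
    mutualInfoS (rTensor (DirectSumIdx k d) N.map φ) =
      Real.logb 2 (∑ i, (d i : ℝ) ^ 2) -
        klDiv q (fun i => (d i : ℝ) ^ 2 / ∑ j, (d j : ℝ) ^ 2) := by
  have hfix : N.map (diagonal fun a => ((q a.1 / (d a.1 : ℝ) : ℝ) : ℂ)) =
      diagonal fun a => ((q a.1 / (d a.1 : ℝ) : ℝ) : ℂ) := by
    ext a b
    rw [hN, of_apply, diagonal_apply]
    by_cases h : a = b <;> simp +contextual [h]
  have hprob : ∀ i, blockProb
      (diagonal fun a : DirectSumIdx k d => ((q a.1 / (d a.1 : ℝ) : ℝ) : ℂ)) i = q i := by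
    intro i
    have : (d i : ℝ) ≠ 0 := by exact_mod_cast (hd i).ne'
    simp only [blockProb, diagonal_apply_eq, Complex.ofReal_re, Finset.sum_const,
      Finset.card_univ, Fintype.card_fin, nsmul_eq_mul]
    field_simp
  rw [mutualInfoS_pinching_eq hN hφ, hfix,
    entropy_diagonal (fun a : DirectSumIdx k d => q a.1 / (d a.1 : ℝ)),
    ← blockUniform_entropy_balance hd hq, Fintype.sum_sigma]
  simp only [hprob, Finset.sum_const, Finset.card_univ, Fintype.card_fin, nsmul_eq_mul]
  ring

/-- The canonical purification of a diagonal state. -/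
lemma exists_isPurification_diagonal {n : Type*} [Fintype n] [DecidableEq n] {f : n → ℝ}
    (hf : IsProbDist f) :
    ∃ φ : Matrix (n × n) (n × n) ℂ, IsPurification φ (diagonal fun a => (f a : ℂ)) := by
  let v : n × n → ℂ := fun x => if x.1 = x.2 then (Real.sqrt (f x.1) : ℂ) else 0
  have hsq : ∀ a, (Real.sqrt (f a) : ℂ) * Real.sqrt (f a) = f a := fun a => by
    rw [← Complex.ofReal_mul, Real.mul_self_sqrt (hf.1 a)]
  refine ⟨vecMulVec v (star v), ⟨posSemidef_vecMulVec_self_star v, ?_⟩, ⟨v, rfl⟩, ?_⟩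
  · simp [Matrix.trace, vecMulVec_apply, v, Fintype.sum_prod_type, apply_ite, hsq,
      ← Complex.ofReal_sum, hf.2]
  · ext a b
    by_cases h : a = b
    · subst h
      simp [ptrR, vecMulVec_apply, v, apply_ite, hsq]
    · simp [ptrR, vecMulVec_apply, v, apply_ite, h]

lemma isState_diagonal {n : Type*} [Fintype n] [DecidableEq n] {f : n → ℝ}
    (hf : IsProbDist f) : IsState (diagonal fun a => (f a : ℂ)) :=
  ⟨PosSemidef.diagonal fun a => by simpa using hf.1 a, by
    rw [trace_diagonal, ← Complex.ofReal_sum, hf.2, Complex.ofReal_one]⟩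

lemma channelMI_pinching (hd : ∀ i, 0 < d i)
    {N : QChannel (DirectSumIdx k d) (DirectSumIdx k d)}
    (hN : ∀ ρ : Matrix (DirectSumIdx k d) (DirectSumIdx k d) ℂ,
      N.map ρ = Matrix.of fun a b => if a.1 = b.1 then ρ a b else 0) :
    channelMI N = Real.logb 2 (∑ i, (d i : ℝ) ^ 2) := by
  rcases isEmpty_or_nonempty (Fin k) with hk | hk
  · have : {r | ∃ (ρA : Matrix (DirectSumIdx k d) (DirectSumIdx k d) ℂ)
        (φ : Matrix (DirectSumIdx k d × DirectSumIdx k d)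
          (DirectSumIdx k d × DirectSumIdx k d) ℂ), IsState ρA ∧ IsPurification φ ρA ∧
        r = mutualInfoS (rTensor (DirectSumIdx k d) N.map φ)} = ∅ := by
      refine Set.eq_empty_of_forall_notMem ?_
      rintro r ⟨ρ, -, hρ, -⟩
      simpa [Matrix.trace] using hρ.2
    rw [channelMI, this]
    simp
  · have hΔ : 0 < ∑ i, (d i : ℝ) ^ 2 :=
      Finset.sum_pos (fun i _ => by have := hd i; positivity) Finset.univ_nonempty
    have hq := dimDist_isProbDist hΔ
    have hf : IsProbDist fun a : DirectSumIdx k d =>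
        (d a.1 : ℝ) ^ 2 / (∑ j, (d j : ℝ) ^ 2) / (d a.1 : ℝ) := by
      refine ⟨fun a => by positivity, ?_⟩
      rw [Fintype.sum_sigma, ← hq.2]
      refine Finset.sum_congr rfl fun i _ => ?_
      have : (d i : ℝ) ≠ 0 := by exact_mod_cast (hd i).ne'
      simp only [Finset.sum_const, Finset.card_univ, Fintype.card_fin, nsmul_eq_mul]
      field_simp
    obtain ⟨φ, hφ⟩ := exists_isPurification_diagonal hf
    refine IsGreatest.csSup_eq ⟨⟨_, φ, isState_diagonal hf, hφ, ?_⟩, ?_⟩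
    · rw [mutualInfoS_pinching_blockUniform hd hN hq hφ, klDiv_self, sub_zero]
    · rintro r ⟨ρ, ψ, hρ, hψ, rfl⟩
      exact mutualInfoS_pinching_le hd hN hρ hψ

end Pinching

/-- mutual information of the pinching channel:
`I(P) = log Δ` with `Δ = Σ_i d_i²`, achieved at `ρ* = Σ_i (d_i/Δ) Π_i`, and on
block-uniform inputs `I(P|ρ_p) = log Δ - D(p ‖ (d_i²/Δ)_i)`. -/
theorem pinching_mutual_information
    {k : ℕ} (d : Fin k → ℕ) (hd : ∀ i, 0 < d i)
    (N : QChannel (DirectSumIdx k d) (DirectSumIdx k d))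
    (hN : ∀ ρ : Matrix (DirectSumIdx k d) (DirectSumIdx k d) ℂ,
      N.map ρ = Matrix.of fun a b => if a.1 = b.1 then ρ a b else 0) :
    channelMI N = Real.logb 2 (∑ i, (d i : ℝ) ^ 2) ∧
    (∀ φ : Matrix (DirectSumIdx k d × DirectSumIdx k d)
        (DirectSumIdx k d × DirectSumIdx k d) ℂ,
      IsPurification φ
        (Matrix.diagonal fun a =>
          (((d a.1 : ℝ) / ∑ i, (d i : ℝ) ^ 2 : ℝ) : ℂ)) →
      mutualInfoS (rTensor (DirectSumIdx k d) N.map φ) = channelMI N) ∧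
    (∀ q : Fin k → ℝ, IsProbDist q →
      ∀ φ : Matrix (DirectSumIdx k d × DirectSumIdx k d)
          (DirectSumIdx k d × DirectSumIdx k d) ℂ,
        IsPurification φ
          (Matrix.diagonal fun a => ((q a.1 / (d a.1 : ℝ) : ℝ) : ℂ)) →
        mutualInfoS (rTensor (DirectSumIdx k d) N.map φ) =
          Real.logb 2 (∑ i, (d i : ℝ) ^ 2) -
            klDiv q (fun i => (d i : ℝ) ^ 2 / ∑ j, (d j : ℝ) ^ 2)) := by
  refine ⟨channelMI_pinching hd hN, fun φ hφ => ?_,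
    fun q hq φ hφ => mutualInfoS_pinching_blockUniform hd hN hq hφ⟩
  rw [channelMI_pinching hd hN]
  rcases isEmpty_or_nonempty (Fin k) with hk | hk
  · simpa [Matrix.trace] using hφ.1.2
  have hΔ : 0 < ∑ i, (d i : ℝ) ^ 2 :=
    Finset.sum_pos (fun i _ => by have := hd i; positivity) Finset.univ_nonempty
  have hρ : (diagonal fun a : DirectSumIdx k d =>
      (((d a.1 : ℝ) / ∑ i, (d i : ℝ) ^ 2 : ℝ) : ℂ)) =
      diagonal fun a => (((d a.1 : ℝ) ^ 2 / (∑ i, (d i : ℝ) ^ 2) / (d a.1 : ℝ) : ℝ) : ℂ) := by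
    congr 1
    funext a
    have : (d a.1 : ℝ) ≠ 0 := by exact_mod_cast (hd a.1).ne'
    congr 1
    field_simp
  rw [hρ] at hφ
  rw [mutualInfoS_pinching_blockUniform hd hN (dimDist_isProbDist hΔ) hφ, klDiv_self, sub_zero]

end QIT
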